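/- arXiv:1603.08125 — 3 statements merged into one kernel-verified Lean document; each statement's English description precedes it below -/
import Mathlib

section
/- Let A_k (2 ≤ k ≤ q) be the intensity matrix of the Pólya urn with types 𝒮_k = {T_1,…,T_{k−1}, *} associated with fringe subtrees of the linear preferential attachment tree, where the normal type T_i has activity a_i = |T_i|(χ+ρ) − χ and the special type * has activity 1. Then: (i) for every normal type T_i, i = 1,…,k−1, except the type that is a path (rooted at an endpoint) of maximal length in 𝒮_k, (A_k)_{ii} = −a_i; (ii) for the normal type T_j that is a path of maximal length among all paths in 𝒮_k, (A_k)_{jj} = ρ − a_j; (iii) for the special type *, (A_k)_{kk} = χ. Consequently, tr(A_k) = χ + ρ − Σ_{j=1}^{k−1} a_j. -/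
open scoped BigOperators

namespace UrnPAT

/-- Rooted trees (with children ordered by their time of addition). -/
inductive PTree : Type
  | node : (k : ℕ) → (Fin k → PTree) → PTree

namespace PTree

/-- The single-node tree. -/
def leaf : PTree := .node 0 (fun i => i.elim0)

/-- The number of nodes. -/
def size : PTree → ℕ
  | .node _ c => 1 + ∑ i, size (c i)

/-- All trees obtained by attaching one new node as a (last) child of some node. -/
def ins : PTree → List PTree
  | .node k c => PTree.node (k + 1) (Fin.snoc c PTree.leaf) ::
      (List.finRange k).flatMap
        (fun i => (ins (c i)).map (fun t => PTree.node k (Function.update c i t)))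

end PTree

/-- `GrowsP t t'` means `t'` can be obtained from `t` by adding nodes
(the partial order `⪯` on rooted trees). -/
def GrowsP : PTree → PTree → Prop :=
  Relation.ReflTransGen (fun a b => b ∈ PTree.ins a)

/-- All trees obtained by attaching one new node, each together with the weight
`w_{d⁺(v)} = χ d⁺(v) + ρ` of the node `v` it was attached to. -/
noncomputable def wins (χ ρ : ℝ) : PTree → List (ℝ × PTree)
  | .node k c =>
    (χ * k + ρ, PTree.node (k + 1) (Fin.snoc c PTree.leaf)) ::
      (List.finRange k).flatMap
        (fun i => (wins χ ρ (c i)).map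
          (fun p => (p.1, PTree.node k (Function.update c i p.2))))

/-- The total weight `Σ_v w_{d⁺(v)}` of a tree (the activity of a normal type). -/
noncomputable def wt (χ ρ : ℝ) : PTree → ℝ
  | .node k c => (χ * k + ρ) + ∑ i, wt χ ρ (c i)

open Classical in
/-- Decompose a tree with respect to the set `S` of living (normal) types and count
the components of type `T`. -/
noncomputable def decompP (S : Set PTree) (T : PTree) : PTree → ℕ
  | .node k c => if PTree.node k c ∈ S then (if PTree.node k c = T then 1 else 0)
      else ∑ i, decompP S T (c i)

open Classical in
/-- The total mass of the special type `*` created by the dead nodes of a tree: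
each dead node of out-degree `d` contributes `w_d = χ d + ρ`. -/
noncomputable def deadMass (χ ρ : ℝ) (S : Set PTree) : PTree → ℝ
  | .node k c => if PTree.node k c ∈ S then 0 else (χ * k + ρ) + ∑ i, deadMass χ ρ S (c i)

open Classical in
/-- The intensity matrix `A_k = (a_j E ξ_{ji})` of the Pólya urn with types
`𝒮_k = {T_1, …, T_{k−1}, *}` (where `τ` enumerates the normal types `T_1, …, T_{q−1}`
and the special type `*` has index `k − 1` and activity `1`): drawing a normal type
adds a child to one of its nodes with probabilities proportional to the node weights
and re-decomposes the result; drawing `*` adds `χ` further mass of type `*` and one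
ball of the single-node type; the drawn ball counts as removed. -/
noncomputable def intensityP (q : ℕ) (τ : Fin (q - 1) → PTree) (χ ρ : ℝ)
    (k : ℕ) (hk : k ≤ q) : Matrix (Fin k) (Fin k) ℝ :=
  Matrix.of fun i j =>
    if hj : (j : ℕ) < k - 1 then
      ((wins χ ρ (τ (Fin.castLE (Nat.sub_le_sub_right hk 1) ⟨(j : ℕ), hj⟩))).map
        (fun p => p.1 *
          (if hi : (i : ℕ) < k - 1 then
            (decompP {t | ∃ s : Fin (q - 1), (s : ℕ) < k - 1 ∧ τ s = t}
              (τ (Fin.castLE (Nat.sub_le_sub_right hk 1) ⟨(i : ℕ), hi⟩)) p.2 : ℝ)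
          else deadMass χ ρ {t | ∃ s : Fin (q - 1), (s : ℕ) < k - 1 ∧ τ s = t} p.2))).sum
      - (if i = j then
          wt χ ρ (τ (Fin.castLE (Nat.sub_le_sub_right hk 1) ⟨(j : ℕ), hj⟩)) else 0)
    else
      (if (i : ℕ) = k - 1 then χ else 0) +
        (if hi : (i : ℕ) < k - 1 then
          (if τ (Fin.castLE (Nat.sub_le_sub_right hk 1) ⟨(i : ℕ), hi⟩) = PTree.leaf
            then 1 else 0)
        else 0)

/-- The path with `n + 1` nodes, rooted at an endpoint. -/
def pathP : ℕ → PTree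
  | 0 => PTree.leaf
  | n + 1 => PTree.node 1 (fun _ => pathP n)

/-- `t` is the path of maximal length among all paths in `S`. -/
def MaxPathP (S : Set PTree) (t : PTree) : Prop :=
  ∃ n, t = pathP n ∧ pathP n ∈ S ∧ pathP (n + 1) ∉ S

end UrnPAT

namespace UrnPAT

namespace PTree

lemma size_pos (t : PTree) : 0 < t.size := by
  cases t with
  | node k c => rw [size]; omega

lemma node_zero (c : Fin 0 → PTree) : node 0 c = leaf := by
  rw [leaf]
  congr 1
  exact Subsingleton.elim _ _

lemma node_one (c : Fin 1 → PTree) : node 1 c = node 1 (fun _ => c 0) := by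
  congr 1
  ext i
  rw [Subsingleton.elim i 0]

lemma node_one_inj {s t : PTree} : node 1 (fun _ => s) = node 1 (fun _ => t) ↔ s = t := by
  constructor
  · intro h
    have h' : (fun _ : Fin 1 => s) = fun _ => t := by simpa using h
    exact congrFun h' 0
  · rintro rfl
    rfl

lemma size_snoc_leaf (k : ℕ) (c : Fin k → PTree) :
    size (node (k + 1) (Fin.snoc c leaf)) = size (node k c) + 1 := by
  rw [size, size, Fin.sum_univ_castSucc]
  simp [leaf, size]
  omega

lemma size_node_update (k : ℕ) (c : Fin k → PTree) (i : Fin k) (t : PTree)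
    (h : t.size = (c i).size + 1) :
    size (node k (Function.update c i t)) = size (node k c) + 1 := by
  rw [size, size, ← Finset.add_sum_erase _ _ (Finset.mem_univ i),
    ← Finset.add_sum_erase _ (fun j => size (c j)) (Finset.mem_univ i)]
  have : ∑ j ∈ Finset.univ.erase i, size (Function.update c i t j)
      = ∑ j ∈ Finset.univ.erase i, size (c j) := by
    refine Finset.sum_congr rfl fun j hj => ?_
    rw [Function.update_of_ne (Finset.ne_of_mem_erase hj)]
  simp only [this, Function.update_self, h]
  omega

lemma size_of_mem_ins {s t : PTree} (h : t ∈ ins s) : t.size = s.size + 1 := by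
  induction s generalizing t with
  | node k c ih =>
    rw [ins, List.mem_cons] at h
    rcases h with rfl | h
    · exact size_snoc_leaf k c
    · simp only [List.mem_flatMap, List.mem_map] at h
      obtain ⟨i, -, u, hu, rfl⟩ := h
      exact size_node_update k c i u (ih i hu)

lemma eq_leaf_or_exists_mem_ins (t : PTree) : t = leaf ∨ ∃ s, t ∈ ins s := by
  induction t with
  | node k c ih =>
    rcases k with _ | k
    · exact Or.inl (node_zero c)
    · right
      rcases ih (Fin.last k) with h | ⟨s, hs⟩
      · refine ⟨node k (Fin.init c), ?_⟩
        rw [ins, ← h, Fin.snoc_init_self]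
        exact List.mem_cons_self
      · refine ⟨node (k + 1) (Function.update c (Fin.last k) s), ?_⟩
        rw [ins]
        refine List.mem_cons_of_mem _ ?_
        simp only [List.mem_flatMap, List.mem_map]
        exact ⟨Fin.last k, List.mem_finRange _, c (Fin.last k), by simpa using hs, by simp⟩

end PTree

open PTree

lemma growsP_leaf (t : PTree) : GrowsP leaf t := by
  induction h : t.size using Nat.strong_induction_on generalizing t with
  | _ n ih =>
    rcases eq_leaf_or_exists_mem_ins t with rfl | ⟨s, hs⟩
    · exact Relation.ReflTransGen.refl
    · have := size_of_mem_ins hs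
      exact (ih s.size (by omega) s rfl).tail hs

lemma pathP_succ_mem_ins (n : ℕ) : pathP (n + 1) ∈ ins (pathP n) := by
  induction n with
  | zero =>
    simp only [pathP, leaf, ins]
    refine List.mem_cons.2 (Or.inl ?_)
    congr 1
  | succ n ih =>
    rw [pathP, pathP, ins]
    refine List.mem_cons_of_mem _ ?_
    simp only [List.mem_flatMap, List.mem_map]
    refine ⟨0, List.mem_finRange _, _, ih, ?_⟩
    rw [node_one, Function.update_self]

lemma growsP_pathP {m n : ℕ} (h : m ≤ n) : GrowsP (pathP m) (pathP n) := by
  induction n, h using Nat.le_induction with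
  | base => exact Relation.ReflTransGen.refl
  | succ n _ ih => exact ih.tail (pathP_succ_mem_ins n)

lemma pathP_injective : Function.Injective pathP := by
  have hsize : ∀ n, (pathP n).size = n + 1 := by
    intro n
    induction n with
    | zero => simp [pathP, leaf, size]
    | succ n ih => simp [pathP, size, ih, add_comm]
  intro m n h
  have := congrArg size h
  rw [hsize, hsize] at this
  omega

lemma size_of_mem_wins {χ ρ : ℝ} {s : PTree} {p : ℝ × PTree} (h : p ∈ wins χ ρ s) :
    p.2.size = s.size + 1 := by
  induction s generalizing p with
  | node k c ih =>
    rw [wins, List.mem_cons] at h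
    rcases h with rfl | h
    · exact size_snoc_leaf k c
    · simp only [List.mem_flatMap, List.mem_map] at h
      obtain ⟨i, -, u, hu, rfl⟩ := h
      exact size_node_update k c i u.2 (ih i hu)

lemma wt_eq (χ ρ : ℝ) (t : PTree) : wt χ ρ t = t.size * (χ + ρ) - χ := by
  induction t with
  | node k c ih =>
    rw [wt, size]
    simp only [ih, Finset.sum_sub_distrib, ← Finset.sum_mul]
    push_cast
    simp
    ring

lemma decompP_of_size_lt (S : Set PTree) {T t : PTree} (h : t.size < T.size) :
    decompP S T t = 0 := by
  induction t with
  | node k c ih =>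
    rw [decompP]
    split_ifs with _ h2
    · rw [h2] at h
      omega
    · rfl
    · refine Finset.sum_eq_zero fun i _ => ih i ?_
      have := Finset.single_le_sum (f := fun j => size (c j)) (fun j _ => Nat.zero_le _)
        (Finset.mem_univ i)
      rw [size] at h
      omega

open Classical in
lemma decompP_of_size_eq {S : Set PTree} {T t : PTree} (hT : T ∈ S) (h : t.size = T.size) :
    decompP S T t = if t = T then 1 else 0 := by
  cases t with
  | node k c =>
    rw [decompP]
    by_cases h1 : node k c ∈ S
    · rw [if_pos h1]
    · rw [if_neg h1, if_neg (by rintro rfl; exact h1 hT)]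
      refine Finset.sum_eq_zero fun i _ => decompP_of_size_lt S ?_
      have := Finset.single_le_sum (f := fun j => size (c j)) (fun j _ => Nat.zero_le _)
        (Finset.mem_univ i)
      rw [size] at h
      omega

open Classical in
/-- A tree with one more node than `T` can only contain a component `T` if it arises from `T` by
adding a parent to the root. -/
lemma decompP_of_size_eq_succ {S : Set PTree} {T t : PTree} (hT : T ∈ S)
    (h : t.size = T.size + 1) :
    decompP S T t = if t = node 1 (fun _ => T) ∧ t ∉ S then 1 else 0 := by
  cases t with
  | node k c =>
    rw [decompP]
    by_cases h1 : node k c ∈ S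
    · rw [if_pos h1, if_neg (by rintro rfl; omega), if_neg (by tauto)]
    rw [if_neg h1]
    simp only [h1, not_false_eq_true, and_true]
    rw [size] at h
    rcases k with _ | _ | k
    · have := size_pos T
      simp at h
      omega
    · rw [Fin.sum_univ_one] at h ⊢
      rw [decompP_of_size_eq hT (by omega), node_one c]
      simp only [node_one_inj]
    · rw [if_neg (by simp)]
      refine Finset.sum_eq_zero fun i _ => decompP_of_size_lt S ?_
      obtain ⟨j, hj⟩ := exists_ne i
      have h2 : size (c i) + size (c j) ≤ ∑ l, size (c l) := by
        rw [← Finset.sum_pair hj.symm (f := fun l => size (c l))]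
        exact Finset.sum_le_sum_of_subset (Finset.subset_univ _)
      have := size_pos (c j)
      omega

open Classical in
/-- Only a path can be extended by one node to the tree that has it as its only root branch. -/
lemma sum_wins_eq_node_one (χ ρ : ℝ) (T : PTree) :
    ((wins χ ρ T).map (fun p => p.1 * (if p.2 = node 1 (fun _ => T) then (1 : ℝ) else 0))).sum
      = if ∃ n, T = pathP n then ρ else 0 := by
  induction T with
  | node k c ih =>
    rw [wins]
    rcases k with _ | _ | k
    · have h1 : ∃ n, node 0 c = pathP n := ⟨0, node_zero c⟩
      have h2 : node (0 + 1) (Fin.snoc c leaf) = node 1 (fun _ => node 0 c) := by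
        rw [node_zero c]
        congr 1
      rw [if_pos h1]
      simp only [List.map_cons, h2, if_true]
      simp
    · have h1 : (∃ n, node 1 c = pathP n) ↔ ∃ n, c 0 = pathP n := by
        rw [node_one c]
        constructor
        · rintro ⟨n, hn⟩
          rcases n with _ | n
          · simp [pathP, leaf] at hn
          · exact ⟨n, node_one_inj.1 hn⟩
        · rintro ⟨n, hn⟩
          exact ⟨n + 1, node_one_inj.2 hn⟩
      have h2 (t : PTree) : node 1 (Function.update c 0 t) = node 1 (fun _ => node 1 c)
          ↔ t = node 1 (fun _ => c 0) := by
        rw [node_one (Function.update c 0 t), node_one_inj, Function.update_self, node_one c]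
      have h3 : List.finRange 1 = [0] := rfl
      simp only [zero_add, h1, ← ih 0]
      simp only [List.map_cons, List.sum_cons, h3, List.flatMap_cons, List.flatMap_nil,
        List.append_nil, List.map_map, Function.comp_def, h2]
      simp
    · have h1 : ¬ ∃ n, node (k + 1 + 1) c = pathP n := by
        rintro ⟨n, hn⟩
        rcases n with _ | n <;> simp [pathP, leaf] at hn
      rw [if_neg h1]
      refine List.sum_eq_zero fun x hx => ?_
      simp only [List.mem_map, List.mem_cons, List.mem_flatMap] at hx
      obtain ⟨p, rfl | ⟨i, -, u, -, rfl⟩, rfl⟩ := hx <;> simp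

open Classical in
lemma sum_wins_decompP (χ ρ : ℝ) {S : Set PTree} {T : PTree} (hT : T ∈ S) :
    ((wins χ ρ T).map (fun p => p.1 * (decompP S T p.2 : ℝ))).sum
      = if MaxPathP S T then ρ else 0 := by
  by_cases hS : node 1 (fun _ => T) ∈ S
  · have h1 : ¬ MaxPathP S T := by
      rintro ⟨n, rfl, -, h⟩
      exact h hS
    rw [if_neg h1]
    refine List.sum_eq_zero fun x hx => ?_
    obtain ⟨p, hp, rfl⟩ := List.mem_map.1 hx
    rw [decompP_of_size_eq_succ hT (size_of_mem_wins hp), if_neg]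
    · simp
    · rintro ⟨h, h'⟩
      exact h' (h ▸ hS)
  · have h1 : MaxPathP S T ↔ ∃ n, T = pathP n := by
      constructor
      · rintro ⟨n, rfl, -⟩
        exact ⟨n, rfl⟩
      · rintro ⟨n, rfl⟩
        exact ⟨n, rfl, hT, hS⟩
    simp only [h1, ← sum_wins_eq_node_one χ ρ T]
    congr 1
    refine List.map_congr_left fun p hp => ?_
    rw [decompP_of_size_eq_succ hT (size_of_mem_wins hp)]
    by_cases h : p.2 = node 1 (fun _ => T)
    · simp [h, hS]
    · simp [h]

open Classical in
lemma intensityP_apply_self (χ ρ : ℝ) (q : ℕ) (τ : Fin (q - 1) → PTree) (k : ℕ) (hk : k ≤ q)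
    (i : Fin k) (hi : (i : ℕ) < k - 1) :
    intensityP q τ χ ρ k hk i i
      = (if MaxPathP {t | ∃ s : Fin (q - 1), (s : ℕ) < k - 1 ∧ τ s = t}
          (τ (Fin.castLE (Nat.sub_le_sub_right hk 1) ⟨(i : ℕ), hi⟩)) then ρ else 0)
        - ((PTree.size (τ (Fin.castLE (Nat.sub_le_sub_right hk 1) ⟨(i : ℕ), hi⟩)) : ℝ)
              * (χ + ρ) - χ) := by
  have hmem : τ (Fin.castLE (Nat.sub_le_sub_right hk 1) ⟨(i : ℕ), hi⟩)
      ∈ {t | ∃ s : Fin (q - 1), (s : ℕ) < k - 1 ∧ τ s = t} := ⟨_, hi, rfl⟩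
  rw [← sum_wins_decompP χ ρ hmem, ← wt_eq]
  simp only [intensityP, Matrix.of_apply, hi, dif_pos, if_true]

lemma intensityP_apply_last (χ ρ : ℝ) (q : ℕ) (τ : Fin (q - 1) → PTree) (k : ℕ) (hk : k ≤ q)
    (i : Fin k) (hi : (i : ℕ) = k - 1) : intensityP q τ χ ρ k hk i i = χ := by
  simp [intensityP, hi]

/-- A finite set of trees that contains the single-node tree and is closed under `⪯` on paths has
exactly one maximal path. -/
lemma existsUnique_maxPathP {S : Set PTree} (hfin : S.Finite) (hleaf : leaf ∈ S)
    (hdown : ∀ a b, b ∈ S → GrowsP a b → a ∈ S) : ∃! t, MaxPathP S t := by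
  classical
  have hN : (pathP ⁻¹' S).Finite := hfin.preimage pathP_injective.injOn
  have hex : ∃ n, pathP n ∉ S := by
    by_contra! h
    exact Set.infinite_univ (hN.subset fun n _ => h n)
  obtain ⟨n, hn⟩ : ∃ n, Nat.find hex = n + 1 := by
    refine Nat.exists_eq_succ_of_ne_zero fun h0 => ?_
    have := Nat.find_spec hex
    rw [h0] at this
    exact this hleaf
  have hmem : pathP n ∈ S := not_not.1 (Nat.find_min hex (by omega))
  have hnot : pathP (n + 1) ∉ S := hn ▸ Nat.find_spec hex
  refine ⟨pathP n, ⟨n, rfl, hmem, hnot⟩, ?_⟩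
  rintro _ ⟨m, rfl, hm, hm'⟩
  rcases lt_trichotomy m n with h | rfl | h
  · exact absurd (hdown _ _ hmem (growsP_pathP h)) hm'
  · rfl
  · exact absurd (hdown _ _ hm (growsP_pathP h)) hnot

/-- **Proposition (diagonal entries and trace of the intensity matrices `A_k` for
linear preferential attachment trees).** Let `𝒮' = {T_1, …, T_{q−1}}` (enumerated
compatibly with `⪯` by `τ`) be a down-set of rooted trees containing the single-node
tree, and for `2 ≤ k ≤ q` let `A_k` be the intensity matrix of the Pólya urn with
types `𝒮_k = {T_1, …, T_{k−1}, *}`, where the normal type `T_i` has activity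
`a_i = |T_i|(χ+ρ) − χ` and the special type `*` has activity `1`. Then:
(i) `(A_k)_{ii} = −a_i` for every normal `T_i` except the maximal path in `𝒮_k`;
(ii) `(A_k)_{jj} = ρ − a_j` for the maximal path `T_j`;
(iii) `(A_k)_{kk} = χ` for the special type; and consequently
`tr A_k = χ + ρ − Σ_{j=1}^{k−1} a_j`. -/
theorem intensityP_diagonal (χ ρ : ℝ)
    (hχ : χ = -1 ∨ χ = 0 ∨ χ = 1) (hρ : 0 < ρ) (hexc : ¬ (χ = -1 ∧ ρ = 1))
    (hint : χ = -1 → ∃ m : ℕ, ρ = m)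
    (q : ℕ) (τ : Fin (q - 1) → PTree)
    (hinj : Function.Injective τ)
    (hleaf : PTree.leaf ∈ Set.range τ)
    (hdown : ∀ (a : PTree) (i : Fin (q - 1)), GrowsP a (τ i) → a ∈ Set.range τ)
    (hcompat : ∀ i j : Fin (q - 1), GrowsP (τ i) (τ j) → i ≤ j)
    (k : ℕ) (hk2 : 2 ≤ k) (hk : k ≤ q) :
    (∀ i : Fin k, ∀ hi : (i : ℕ) < k - 1,
      ¬ MaxPathP {t | ∃ s : Fin (q - 1), (s : ℕ) < k - 1 ∧ τ s = t}
          (τ (Fin.castLE (Nat.sub_le_sub_right hk 1) ⟨(i : ℕ), hi⟩)) →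
        intensityP q τ χ ρ k hk i i
          = -((PTree.size (τ (Fin.castLE (Nat.sub_le_sub_right hk 1) ⟨(i : ℕ), hi⟩)) : ℝ)
              * (χ + ρ) - χ)) ∧
    (∀ i : Fin k, ∀ hi : (i : ℕ) < k - 1,
      MaxPathP {t | ∃ s : Fin (q - 1), (s : ℕ) < k - 1 ∧ τ s = t}
          (τ (Fin.castLE (Nat.sub_le_sub_right hk 1) ⟨(i : ℕ), hi⟩)) →
        intensityP q τ χ ρ k hk i i
          = ρ - ((PTree.size (τ (Fin.castLE (Nat.sub_le_sub_right hk 1) ⟨(i : ℕ), hi⟩)) : ℝ)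
              * (χ + ρ) - χ)) ∧
    (∀ i : Fin k, (i : ℕ) = k - 1 → intensityP q τ χ ρ k hk i i = χ) ∧
    (intensityP q τ χ ρ k hk).trace
      = χ + ρ - ∑ j : Fin (k - 1),
          ((PTree.size (τ (Fin.castLE (Nat.sub_le_sub_right hk 1) j)) : ℝ) * (χ + ρ) - χ) := by
  classical
  refine ⟨fun i hi h => ?_, fun i hi h => ?_,
    fun i hi => intensityP_apply_last χ ρ q τ k hk i hi, ?_⟩
  · rw [intensityP_apply_self χ ρ q τ k hk i hi, if_neg h, zero_sub]
  · rw [intensityP_apply_self χ ρ q τ k hk i hi, if_pos h]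
  · obtain ⟨m, rfl⟩ : ∃ m, k = m + 1 := ⟨k - 1, by omega⟩
    set S : Set PTree := {t | ∃ s : Fin (q - 1), (s : ℕ) < m + 1 - 1 ∧ τ s = t}
    have hSfin : S.Finite := (Set.finite_range τ).subset (by rintro _ ⟨s, -, rfl⟩; exact ⟨s, rfl⟩)
    have hSdown : ∀ a b, b ∈ S → GrowsP a b → a ∈ S := by
      rintro a _ ⟨s, hs, rfl⟩ hab
      obtain ⟨s', rfl⟩ := hdown a s hab
      exact ⟨s', lt_of_le_of_lt (hcompat s' s hab) hs, rfl⟩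
    have hSleaf : PTree.leaf ∈ S :=
      hSdown _ (τ ⟨0, by omega⟩) ⟨_, by simp only; omega, rfl⟩ (growsP_leaf _)
    obtain ⟨t, ht, huniq⟩ := existsUnique_maxPathP hSfin hSleaf hSdown
    obtain ⟨s, hs, hst⟩ : t ∈ S := by
      obtain ⟨n, rfl, h, -⟩ := ht
      exact h
    have hmax : ∀ j : Fin m, MaxPathP S (τ (Fin.castLE (Nat.sub_le_sub_right hk 1) j))
        ↔ j = ⟨s, hs⟩ := by
      intro j
      constructor
      · intro h
        have := hinj ((huniq _ h).trans hst.symm)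
        ext
        simpa using congrArg Fin.val this
      · rintro rfl
        have : Fin.castLE (Nat.sub_le_sub_right hk 1) (⟨s, hs⟩ : Fin (m + 1 - 1)) = s := rfl
        rw [this, hst]
        exact ht
    rw [Matrix.trace, Fin.sum_univ_castSucc]
    simp only [Matrix.diag_apply]
    rw [intensityP_apply_last χ ρ q τ (m + 1) hk (Fin.last m) (by simp)]
    have hdiag : ∀ j : Fin m, intensityP q τ χ ρ (m + 1) hk j.castSucc j.castSucc
        = (if j = ⟨s, hs⟩ then ρ else 0)
          - ((PTree.size (τ (Fin.castLE (Nat.sub_le_sub_right hk 1) j)) : ℝ) * (χ + ρ) - χ) := by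
      intro j
      rw [intensityP_apply_self χ ρ q τ (m + 1) hk j.castSucc (by simp)]
      simp only [← hmax j]
      rfl
    rw [Finset.sum_congr rfl fun j _ => hdiag j, Finset.sum_sub_distrib, Finset.sum_ite_eq']
    simp only [Finset.mem_univ, if_true]
    exact (by intros; ring : ∀ a b c : ℝ, a - b + c = c + a - b) _ _ _

end UrnPAT
end

section
/- For the linear preferential attachment trees with weights w_k = χ·k + ρ (ρ > 0), the eigenvalues of the intensity matrix A = A_q of the fringe-subtree Pólya urn with types {T_1,…,T_{q−1}, *}, counted with algebraic multiplicity, are χ + ρ together with −a_i for i = 1,…,q−1, where a_i = |T_i|(χ+ρ) − χ is the activity (total weight) of the normal type T_i. -/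
open scoped BigOperators

namespace UrnPAT

open Polynomial

open PTree

variable {χ ρ : ℝ}

/-- The weighted sum of `g` over all trees obtained from `t` by attaching one node. -/
noncomputable def winSum (χ ρ : ℝ) (g : PTree → ℝ) (t : PTree) : ℝ :=
  ((wins χ ρ t).map (fun p => p.1 * g p.2)).sum

lemma winSum_node (g : PTree → ℝ) (k : ℕ) (c : Fin k → PTree) :
    winSum χ ρ g (.node k c) = (χ * k + ρ) * g (.node (k + 1) (Fin.snoc c leaf)) +
      ∑ i, winSum χ ρ (fun t => g (.node k (Function.update c i t))) (c i) := by
  have h (l : List (Fin k)) (F : Fin k → List (ℝ × PTree)) :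
      ((l.flatMap F).map (fun p => p.1 * g p.2)).sum =
        (l.map (fun i => ((F i).map (fun p => p.1 * g p.2)).sum)).sum := by
    induction l with
    | nil => simp
    | cons a l ih => simp [ih]
  rw [winSum, wins, List.map_cons, List.sum_cons, h, ← List.ofFn_eq_map, List.sum_ofFn]
  simp [winSum, Function.comp_def]

lemma winSum_add (f g : PTree → ℝ) (t : PTree) :
    winSum χ ρ (fun t => f t + g t) t = winSum χ ρ f t + winSum χ ρ g t := by
  simp [winSum, mul_add, List.sum_map_add]

lemma winSum_mul_const (f : PTree → ℝ) (a : ℝ) (t : PTree) :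
    winSum χ ρ (fun t => f t * a) t = winSum χ ρ f t * a := by
  simp only [winSum, ← mul_assoc, List.sum_map_mul_right]

lemma winSum_one (t : PTree) : winSum χ ρ (fun _ => 1) t = wt χ ρ t := by
  induction t with
  | node k c ih => simp [winSum_node, wt, ih]

lemma winSum_const (a : ℝ) (t : PTree) : winSum χ ρ (fun _ => a) t = wt χ ρ t * a := by
  rw [← winSum_one, ← winSum_mul_const]
  simp

lemma winSum_congr {f g : PTree → ℝ} {t : PTree}
    (h : ∀ p ∈ wins χ ρ t, f p.2 = g p.2) : winSum χ ρ f t = winSum χ ρ g t := by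
  unfold winSum
  congr 1
  exact List.map_congr_left fun p hp => by rw [h p hp]

lemma winSum_sum {ι : Type*} (s : Finset ι) (f : ι → PTree → ℝ) (t : PTree) :
    winSum χ ρ (fun t => ∑ i ∈ s, f i t) t = ∑ i ∈ s, winSum χ ρ (f i) t := by
  classical
  induction s using Finset.induction_on with
  | empty => simp [winSum_const]
  | insert a s ha ih => simp [Finset.sum_insert ha, winSum_add, ih]

lemma mem_ins_of_mem_wins {t : PTree} {p : ℝ × PTree} (hp : p ∈ wins χ ρ t) :
    p.2 ∈ ins t := by
  induction t generalizing p with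
  | node k c ih =>
    rw [wins, List.mem_cons, List.mem_flatMap] at hp
    rw [ins, List.mem_cons, List.mem_flatMap]
    rcases hp with rfl | ⟨i, hi, hp⟩
    · exact Or.inl rfl
    · obtain ⟨r, hr, rfl⟩ := List.mem_map.1 hp
      exact Or.inr ⟨i, hi, List.mem_map.2 ⟨r.2, ih i hr, rfl⟩⟩

lemma size_of_mem_ins {t a : PTree} (ha : a ∈ ins t) : a.size = t.size + 1 := by
  induction t generalizing a with
  | node k c ih =>
    rw [ins, List.mem_cons, List.mem_flatMap] at ha
    rcases ha with rfl | ⟨i, -, ha⟩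
    · simp [size, Fin.sum_univ_castSucc, leaf, add_assoc]
    · obtain ⟨r, hr, rfl⟩ := List.mem_map.1 ha
      have := ih i hr
      simp only [size]
      rw [← Finset.add_sum_erase _ _ (Finset.mem_univ i),
        ← Finset.add_sum_erase _ (fun j => size (c j)) (Finset.mem_univ i),
        Finset.sum_congr rfl (g := fun j => size (c j))]
      · simp [this]
        omega
      · intro j hj
        rw [Function.update_of_ne (Finset.ne_of_mem_erase hj)]

lemma wt_eq_size (t : PTree) : wt χ ρ t = (size t : ℝ) * (χ + ρ) - χ := by
  induction t with
  | node k c ih =>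
    simp only [wt, size, ih, Finset.sum_sub_distrib, ← Finset.sum_mul]
    simp
    ring

/-- The generator of the tree growth, acting on functions on trees. -/
noncomputable def gen (χ ρ : ℝ) (f : PTree → ℝ) (t : PTree) : ℝ :=
  winSum χ ρ f t - wt χ ρ t * f t

/-- The failure of a function `f` on trees, with value `s` on the dead type, to be additive
when the root is removed. -/
noncomputable def defect (χ ρ : ℝ) (f : PTree → ℝ) (s : ℝ) : PTree → ℝ
  | .node k c => f (.node k c) - ∑ i, f (c i) - (χ * k + ρ) * s

lemma sum_update (f : PTree → ℝ) {k : ℕ} (c : Fin k → PTree) (i : Fin k) (t : PTree) :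
    ∑ j, f (Function.update c i t j) = f t + (∑ j, f (c j) - f (c i)) := by
  rw [← Finset.add_sum_erase _ _ (Finset.mem_univ i),
    ← Finset.add_sum_erase _ (fun j => f (c j)) (Finset.mem_univ i),
    Finset.sum_congr rfl (g := fun j => f (c j))]
  · simp
  · intro j hj
    rw [Function.update_of_ne (Finset.ne_of_mem_erase hj)]

/-- Taking defects commutes with the generator. -/
lemma defect_gen (f : PTree → ℝ) (s : ℝ) (t : PTree) :
    defect χ ρ (gen χ ρ f) (f leaf + χ * s) t = gen χ ρ (defect χ ρ f s) t := by
  obtain ⟨k, c⟩ := t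
  have h (i : Fin k) :
      winSum χ ρ (fun t => defect χ ρ f s (.node k (Function.update c i t))) (c i) =
        winSum χ ρ (fun t => f (.node k (Function.update c i t))) (c i) -
        winSum χ ρ f (c i) + wt χ ρ (c i) * f (c i) -
        wt χ ρ (c i) * (∑ j, f (c j) + (χ * k + ρ) * s) := by
    have : (fun t => defect χ ρ f s (.node k (Function.update c i t))) = fun t =>
        f (.node k (Function.update c i t)) + (f t * (-1) +
          (f (c i) - (∑ j, f (c j) + (χ * k + ρ) * s))) := by
      funext t
      rw [defect, sum_update]
      ring
    rw [this, winSum_add, winSum_add, winSum_mul_const, winSum_const]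
    ring
  simp only [gen, winSum_node, h, wt]
  simp only [defect, gen, winSum_node, wt, Finset.sum_add_distrib, Finset.sum_sub_distrib,
    ← Finset.sum_mul, Fin.sum_univ_castSucc, Fin.snoc_castSucc, Fin.snoc_last]
  push_cast
  ring

section Urn

variable {n : ℕ} (τ : Fin n → PTree)

/-- The extension to all trees, through the decomposition into components, of a linear
functional on the space of urn compositions. -/
noncomputable def ext (χ ρ : ℝ) (φ : Fin (n + 1) → ℝ) (t : PTree) : ℝ :=
  ∑ i : Fin n, φ i.castSucc * decompP (Set.range τ) (τ i) t +
    φ (Fin.last n) * deadMass χ ρ (Set.range τ) t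

variable {τ}

lemma ext_apply (hinj : Function.Injective τ) (φ : Fin (n + 1) → ℝ) (j : Fin n) :
    ext τ χ ρ φ (τ j) = φ j.castSucc := by
  have h1 (T : PTree) [Decidable (τ j = T)] :
      decompP (Set.range τ) T (τ j) = if τ j = T then 1 else 0 := by
    have hm : τ j ∈ Set.range τ := ⟨j, rfl⟩
    generalize τ j = t at *
    obtain ⟨k, c⟩ := t
    rw [decompP, if_pos hm]
    congr
  have h2 : deadMass χ ρ (Set.range τ) (τ j) = 0 := by
    have hm : τ j ∈ Set.range τ := ⟨j, rfl⟩
    generalize τ j = t at *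
    obtain ⟨k, c⟩ := t
    rw [deadMass, if_pos hm]
  classical
  simp [ext, h1, h2, hinj.eq_iff]

lemma defect_ext {t : PTree} (ht : t ∉ Set.range τ) (φ : Fin (n + 1) → ℝ) :
    defect χ ρ (ext τ χ ρ φ) (φ (Fin.last n)) t = 0 := by
  obtain ⟨k, c⟩ := t
  simp only [defect, ext, decompP, deadMass, if_neg ht, Finset.sum_add_distrib, mul_add,
    Nat.cast_sum, Finset.mul_sum]
  rw [Finset.sum_comm]
  ring

/-- A function whose defect vanishes outside the living types is determined by its values on
the living types and the dead type. -/
lemma eq_of_defect_eq_zero {f g : PTree → ℝ} {s : ℝ} {S : Set PTree}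
    (hS : ∀ t ∈ S, f t = g t) (hf : ∀ t ∉ S, defect χ ρ f s t = 0)
    (hg : ∀ t ∉ S, defect χ ρ g s t = 0) (t : PTree) : f t = g t := by
  induction t with
  | node k c ih =>
    by_cases ht : PTree.node k c ∈ S
    · exact hS _ ht
    · have h1 := hf _ ht
      have h2 := hg _ ht
      simp only [defect, ih] at h1 h2
      linarith

lemma vecMul_intensityP_castSucc (φ : Fin (n + 1) → ℝ) (hinj : Function.Injective τ)
    (j : Fin n) :
    (Matrix.vecMul φ (intensityP (n + 1) τ χ ρ (n + 1) le_rfl)) j.castSucc =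
      gen χ ρ (ext τ χ ρ φ) (τ j) := by
  rw [gen, ext_apply hinj]
  unfold ext
  rw [winSum_add, winSum_sum, Matrix.vecMul, dotProduct, Fin.sum_univ_castSucc]
  simp only [mul_comm (φ _), winSum_mul_const]
  simp [intensityP, winSum, sub_mul, Finset.sum_sub_distrib, Set.range,
    (Fin.castSucc_lt_last j).ne']
  ring

lemma vecMul_intensityP_last (φ : Fin (n + 1) → ℝ) (hinj : Function.Injective τ)
    (hleaf : leaf ∈ Set.range τ) :
    (Matrix.vecMul φ (intensityP (n + 1) τ χ ρ (n + 1) le_rfl)) (Fin.last n) =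
      ext τ χ ρ φ leaf + χ * φ (Fin.last n) := by
  classical
  obtain ⟨l, hl⟩ := hleaf
  rw [← hl, ext_apply hinj, Matrix.vecMul, dotProduct, Fin.sum_univ_castSucc]
  have hne (i : Fin n) : (i : ℕ) ≠ n := i.isLt.ne
  simp [intensityP, ← hl, hinj.eq_iff, mul_comm, hne]

/-- The intensity matrix acts on functionals as the generator of the tree growth. -/
lemma ext_vecMul_intensityP (φ : Fin (n + 1) → ℝ) (hinj : Function.Injective τ)
    (hleaf : leaf ∈ Set.range τ) (hdown : ∀ t, ∀ a ∈ ins t, a ∈ Set.range τ → t ∈ Set.range τ) :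
    ext τ χ ρ (Matrix.vecMul φ (intensityP (n + 1) τ χ ρ (n + 1) le_rfl)) =
      gen χ ρ (ext τ χ ρ φ) := by
  funext t
  refine eq_of_defect_eq_zero (χ := χ) (ρ := ρ) (S := Set.range τ) ?_
    (fun t ht => defect_ext ht _) ?_ t
  · rintro _ ⟨j, rfl⟩
    rw [ext_apply hinj, vecMul_intensityP_castSucc φ hinj]
  · intro t ht
    rw [vecMul_intensityP_last φ hinj hleaf, defect_gen, gen, defect_ext ht, mul_zero, sub_zero,
      winSum_congr (g := fun _ => 0), winSum_const, mul_zero]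
    exact fun p hp => defect_ext (fun h => ht (hdown t _ (mem_ins_of_mem_wins hp) h)) _

variable (τ)

/-- The coordinates of a functional given by its value on the dead type and its defects. -/
noncomputable def defectCoords (χ ρ : ℝ) : (Fin (n + 1) → ℝ) →ₗ[ℝ] (Fin (n + 1) → ℝ) where
  toFun φ := Fin.cons (φ (Fin.last n))
    (fun j => defect χ ρ (ext τ χ ρ φ) (φ (Fin.last n)) (τ j))
  map_add' φ ψ := by
    funext i
    refine Fin.cases (by simp) (fun j => ?_) i
    simp only [Pi.add_apply, Fin.cons_succ]
    generalize τ j = t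
    obtain ⟨k, c⟩ := t
    simp only [defect, ext, Pi.add_apply, add_mul, Finset.sum_add_distrib]
    ring
  map_smul' a φ := by
    funext i
    refine Fin.cases (by simp) (fun j => ?_) i
    simp only [Pi.smul_apply, Fin.cons_succ, smul_eq_mul, RingHom.id_apply]
    generalize τ j = t
    obtain ⟨k, c⟩ := t
    simp only [defect, ext, Pi.smul_apply, smul_eq_mul, mul_assoc, ← Finset.mul_sum, ← mul_add]
    ring

open Classical in
/-- The transposed intensity matrix in defect coordinates. -/
noncomputable def growthMatrix (χ ρ : ℝ) : Matrix (Fin (n + 1)) (Fin (n + 1)) ℝ :=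
  Matrix.of (Fin.cons (Fin.cons (χ + ρ) (fun i => if leaf = τ i then 1 else 0))
    (fun j => Fin.cons 0 (fun i => gen χ ρ (fun t => if t = τ i then 1 else 0) (τ j))))

variable {τ}

lemma defectCoords_injective (hinj : Function.Injective τ) :
    Function.Injective (defectCoords τ χ ρ) := by
  rw [injective_iff_map_eq_zero]
  intro φ h
  have h0 : φ (Fin.last n) = 0 := by simpa [defectCoords] using congrFun h 0
  have hS (t : PTree) : defect χ ρ (ext τ χ ρ φ) 0 t = 0 := by
    by_cases ht : t ∈ Set.range τ
    · obtain ⟨j, rfl⟩ := ht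
      simpa [defectCoords, h0] using congrFun h j.succ
    · simpa [h0] using defect_ext (χ := χ) (ρ := ρ) ht φ
  have hz := eq_of_defect_eq_zero (χ := χ) (ρ := ρ) (S := ∅) (g := fun _ => 0) (by simp)
    (fun t _ => hS t) (fun t _ => by cases t; simp [defect])
  funext i
  refine Fin.lastCases h0 (fun j => ?_) i
  rw [← ext_apply (χ := χ) (ρ := ρ) hinj φ j, hz]
  rfl

lemma defectCoords_vecMul_intensityP (φ : Fin (n + 1) → ℝ) (hinj : Function.Injective τ)
    (hleaf : leaf ∈ Set.range τ) (hdown : ∀ t, ∀ a ∈ ins t, a ∈ Set.range τ → t ∈ Set.range τ) :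
    defectCoords τ χ ρ (Matrix.vecMul φ (intensityP (n + 1) τ χ ρ (n + 1) le_rfl)) =
      (growthMatrix τ χ ρ).mulVec (defectCoords τ χ ρ φ) := by
  classical
  have key (t : PTree) : defect χ ρ (ext τ χ ρ φ) (φ (Fin.last n)) t =
      ∑ i, (if t = τ i then 1 else 0) *
        defect χ ρ (ext τ χ ρ φ) (φ (Fin.last n)) (τ i) := by
    by_cases ht : t ∈ Set.range τ
    · obtain ⟨j, rfl⟩ := ht
      simp [hinj.eq_iff]
    · rw [defect_ext ht, Finset.sum_eq_zero]
      intro i _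
      rw [if_neg (fun h => ht ⟨i, h.symm⟩), zero_mul]
  funext i
  refine Fin.cases ?_ (fun j => ?_) i
  · have h := key leaf
    have hd : defect χ ρ (ext τ χ ρ φ) (φ (Fin.last n)) leaf =
        ext τ χ ρ φ leaf - ρ * φ (Fin.last n) := by simp [defect, leaf]
    rw [hd] at h
    simp only [Matrix.mulVec, dotProduct, Fin.sum_univ_succ, growthMatrix, Matrix.of_apply,
      defectCoords, LinearMap.coe_mk, AddHom.coe_mk, Fin.cons_zero, Fin.cons_succ,
      vecMul_intensityP_last φ hinj hleaf]
    linarith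
  · simp only [Matrix.mulVec, dotProduct, Fin.sum_univ_succ, growthMatrix, Matrix.of_apply,
      defectCoords, LinearMap.coe_mk, AddHom.coe_mk, Fin.cons_zero, Fin.cons_succ,
      vecMul_intensityP_last φ hinj hleaf, ext_vecMul_intensityP φ hinj hleaf hdown, defect_gen]
    rw [gen, winSum_congr (g := fun t => ∑ i, (if t = τ i then 1 else 0) *
      defect χ ρ (ext τ χ ρ φ) (φ (Fin.last n)) (τ i)) (fun p _ => key p.2), winSum_sum, key (τ j)]
    simp only [gen, sub_mul, Finset.sum_sub_distrib, winSum_mul_const, zero_mul, zero_add,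
      Finset.mul_sum, mul_assoc]

lemma charpoly_intensityP (hinj : Function.Injective τ)
    (hleaf : leaf ∈ Set.range τ) (hdown : ∀ t, ∀ a ∈ ins t, a ∈ Set.range τ → t ∈ Set.range τ) :
    (intensityP (n + 1) τ χ ρ (n + 1) le_rfl).charpoly = (growthMatrix τ χ ρ).charpoly := by
  set A := intensityP (n + 1) τ χ ρ (n + 1) le_rfl
  let e := LinearEquiv.ofInjectiveEndo _ (defectCoords_injective (χ := χ) (ρ := ρ) hinj)
  have h : e.conj (Matrix.toLin' A.transpose) = Matrix.toLin' (growthMatrix τ χ ρ) := by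
    refine LinearMap.ext fun ψ => ?_
    obtain ⟨φ, rfl⟩ := e.surjective ψ
    rw [LinearEquiv.conj_apply_apply, e.symm_apply_apply, Matrix.toLin'_apply,
      Matrix.toLin'_apply, Matrix.mulVec_transpose]
    exact defectCoords_vecMul_intensityP φ hinj hleaf hdown
  rw [← Matrix.charpoly_transpose, ← Matrix.charpoly_toLin', ← LinearEquiv.charpoly_conj e, h,
    Matrix.charpoly_toLin']

lemma growthMatrix_charpoly (hinj : Function.Injective τ)
    (hcompat : ∀ i j, τ j ∈ ins (τ i) → i < j) :
    (growthMatrix τ χ ρ).charpoly =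
      (X - C (χ + ρ)) * ∏ i, (X + C ((size (τ i) : ℝ) * (χ + ρ) - χ)) := by
  classical
  have hwin (i j : Fin n) (h : j ≤ i) :
      winSum χ ρ (fun t => if t = τ j then 1 else 0) (τ i) = 0 := by
    rw [winSum_congr (g := fun _ => 0), winSum_const, mul_zero]
    refine fun p hp => if_neg fun hpj => h.not_gt (hcompat i j ?_)
    rw [← hpj]
    exact mem_ins_of_mem_wins hp
  have htri : (growthMatrix τ χ ρ).IsUpperTriangular := by
    intro i j hij
    induction i using Fin.cases with
    | zero => exact absurd hij (Fin.not_lt_zero _)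
    | succ i =>
      induction j using Fin.cases with
      | zero => rfl
      | succ j =>
        have hij : j < i := Fin.succ_lt_succ_iff.1 hij
        have hne : τ i ≠ τ j := hinj.ne hij.ne'
        simp [growthMatrix, gen, hwin i j hij.le, hne]
  rw [Matrix.charpoly_of_isUpperTriangular _ htri, Fin.prod_univ_succ]
  congr 1
  refine Finset.prod_congr rfl fun i _ => ?_
  simp [growthMatrix, gen, hwin i i le_rfl, wt_eq_size, sub_eq_add_neg]

end Urn

/-- **Theorem (eigenvalues of the intensity matrix of the fringe-subtree urn for
linear preferential attachment trees).** For weights `w_j = χ j + ρ` (`ρ > 0`),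
the eigenvalues of the intensity matrix `A = A_q` of the Pólya urn with types
`{T_1, …, T_{q−1}, *}` (where `τ` enumerates, compatibly with `⪯`, a down-set of
rooted trees containing the single-node tree), counted with algebraic multiplicity,
are `χ + ρ` together with `−a_i` for `i = 1, …, q − 1`, where
`a_i = |T_i|(χ+ρ) − χ` is the activity of the normal type `T_i` (stated as a
factorization of the characteristic polynomial). -/
theorem intensityP_eigenvalues (χ ρ : ℝ)
    (hχ : χ = -1 ∨ χ = 0 ∨ χ = 1) (hρ : 0 < ρ) (hexc : ¬ (χ = -1 ∧ ρ = 1))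
    (hint : χ = -1 → ∃ m : ℕ, ρ = m)
    (q : ℕ) (hq : 2 ≤ q) (τ : Fin (q - 1) → PTree)
    (hinj : Function.Injective τ)
    (hleaf : PTree.leaf ∈ Set.range τ)
    (hdown : ∀ (a : PTree) (i : Fin (q - 1)), GrowsP a (τ i) → a ∈ Set.range τ)
    (hcompat : ∀ i j : Fin (q - 1), GrowsP (τ i) (τ j) → i ≤ j) :
    (intensityP q τ χ ρ q le_rfl).charpoly
      = (X - C (χ + ρ)) *
          ∏ i : Fin (q - 1), (X + C ((PTree.size (τ i) : ℝ) * (χ + ρ) - χ)) := by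
  obtain ⟨n, rfl⟩ : ∃ n, q = n + 1 := ⟨q - 1, by omega⟩
  refine (charpoly_intensityP (n := n) hinj hleaf ?_).trans (growthMatrix_charpoly hinj ?_)
  · rintro t _ ha ⟨j, rfl⟩
    exact hdown t j (.single ha)
  · intro i j h
    refine lt_of_le_of_ne (hcompat i j (.single h)) ?_
    rintro rfl
    have := size_of_mem_ins h
    omega

end UrnPAT
end

section
/- For m ≥ 3, let A_k (m−1 ≤ k ≤ q, q = m − 1 + C(2m, m)) be the intensity matrix of the reduced Pólya urn 𝒳_n^k used to count protected nodes in the random m-ary search tree, with activities a_i. Then (A_k)_{ii} = −a_i for every type i = 1,…,k; that is, whenever a ball of type i is drawn, it is never replaced by a ball of the same type. -/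
open scoped BigOperators

namespace ProtUrn

/-- The composite types of the protected-nodes urn for `m`-ary search trees are
described by vectors `x : Fin m → ℕ` (with `Σ x ≤ m`), where `x i` is the number of
children of the (full) root holding `i` keys. `val` reads such a vector as a
base-`(m+1)` number with `x 0` most significant. -/
def val (m : ℕ) (x : Fin m → ℕ) : ℕ := ∑ i, x i * (m + 1) ^ (m - 1 - (i : ℕ))

/-- The enumeration order on composite types: types with more children precede
types with fewer children, ties broken by decreasing base-`(m+1)` value. -/
def OrdGT (m : ℕ) (x y : Fin m → ℕ) : Prop :=
  (∑ i, y i) < (∑ i, x i) ∨ ((∑ i, x i) = (∑ i, y i) ∧ val m y < val m x)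

/-- The activity (number of gaps) of a composite type: each child holding `i` keys
contributes `i + 1` gaps. -/
def activity (m : ℕ) (x : Fin m → ℕ) : ℕ := ∑ i : Fin m, ((i : ℕ) + 1) * x i

/-- Add one child with `c` keys. -/
def addE (m : ℕ) (x : Fin m → ℕ) (c : ℕ) : Fin m → ℕ :=
  fun i => if (i : ℕ) = c then x i + 1 else x i

/-- Remove one child with `c` keys. -/
def subE (m : ℕ) (x : Fin m → ℕ) (c : ℕ) : Fin m → ℕ :=
  fun i => if (i : ℕ) = c then x i - 1 else x i

/-- The type `(m, 0, …, 0)`: a full root with `m` external children. -/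
def fullVec (m : ℕ) : Fin m → ℕ := fun i => if (i : ℕ) = 0 then m else 0

/-- The type `(m−1, 1, 0, …, 0)` created when a full child becomes a non-leaf. -/
def spawnVec (m : ℕ) : Fin m → ℕ :=
  fun i => if (i : ℕ) = 0 then m - 1 else if (i : ℕ) = 1 then 1 else 0

/-- Deleting the root of a composite type `x` in the urn reduced to `k` types:
each child holding `c ≤ m − 2` keys becomes a single node (type `c`, `0`-indexed),
each full child becomes a ball of type `m − 1` (the type `(m, 0, …, 0)`); if
`k = m − 1` the latter type is absent and each full child is further replaced by its
`m` external children. -/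
noncomputable def singles (m k : ℕ) (hm : 2 ≤ m) (x : Fin m → ℕ) : Fin k → ℝ := fun i =>
  if h : (i : ℕ) < m - 1 then
    (x ⟨(i : ℕ), by omega⟩ : ℝ) +
      (if k < m ∧ (i : ℕ) = 0 then (m : ℝ) * (x ⟨m - 1, by omega⟩ : ℝ) else 0)
  else if (i : ℕ) = m - 1 then (x ⟨m - 1, by omega⟩ : ℝ) else 0

/-- The vector of balls representing a composite type `x` in the urn reduced to the
types `0, …, k − 1` (global index of `x` is `m − 1 + τ⁻¹ x`): keep it if its index
is `< k`, otherwise delete the root. -/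
noncomputable def red (m N : ℕ) (hm : 2 ≤ m) (τinv : (Fin m → ℕ) → Fin N) (k : ℕ)
    (x : Fin m → ℕ) : Fin k → ℝ := fun i =>
  if m - 1 + (τinv x : ℕ) < k then (if (i : ℕ) = m - 1 + (τinv x : ℕ) then 1 else 0)
  else singles m k hm x i

/-- The intensity matrix `A_k = (a_j E ξ^{(k)}_{ji})` of the reduced Pólya urn
`𝒳_n^k` used to count protected nodes in random `m`-ary search trees. Types
(0-indexed): type `i < m − 1` is a single node with `i` keys (activity `i + 1`);
type `m − 1 + s` is the composite type `τ s` (activity `Σ_i (i+1) (τ s) i`). When a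
ball is drawn, a key is inserted into a uniformly chosen gap: a single node gains a
key (becoming the full type `(m, 0, …, 0)` when it had `m − 2` keys); in a composite
type, a child with `c ≤ m − 2` keys (chosen with probability proportional to its
`c + 1` gaps) gains a key, while inserting into one of the `m` gaps of a full child
splits off a new tree of type `(m−1, 1, 0, …, 0)`; the resulting types are reduced
(roots of types `≥ k` are deleted), and the drawn ball counts as removed. -/
noncomputable def intensityProt (m N : ℕ) (hm : 2 ≤ m) (τ : Fin N → Fin m → ℕ)
    (τinv : (Fin m → ℕ) → Fin N) (k : ℕ) (hk : k ≤ m - 1 + N) :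
    Matrix (Fin k) (Fin k) ℝ :=
  Matrix.of fun i j =>
    if hj1 : (j : ℕ) < m - 2 then
      (((j : ℕ) : ℝ) + 1) *
        ((if (i : ℕ) = (j : ℕ) + 1 then 1 else 0) - (if i = j then 1 else 0))
    else if hj2 : (j : ℕ) = m - 2 then
      ((m : ℝ) - 1) * (red m N hm τinv k (fullVec m) i - (if i = j then 1 else 0))
    else
      (∑ c : Fin (m - 1),
        (((c : ℕ) : ℝ) + 1) *
          ((τ ⟨(j : ℕ) - (m - 1), by have := j.isLt; omega⟩) (Fin.castLE (by omega) c) : ℝ) *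
          red m N hm τinv k
            (addE m (subE m (τ ⟨(j : ℕ) - (m - 1), by have := j.isLt; omega⟩) (c : ℕ))
              ((c : ℕ) + 1)) i)
      + (m : ℝ) * ((τ ⟨(j : ℕ) - (m - 1), by have := j.isLt; omega⟩) ⟨m - 1, by omega⟩ : ℝ) *
          (red m N hm τinv k
              (subE m (τ ⟨(j : ℕ) - (m - 1), by have := j.isLt; omega⟩) (m - 1)) i
            + red m N hm τinv k (spawnVec m) i)
      - (activity m (τ ⟨(j : ℕ) - (m - 1), by have := j.isLt; omega⟩) : ℝ) *
          (if i = j then 1 else 0)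

/-- The activity of the type with global index `i` in the reduced urn. -/
noncomputable def actGlobal (m N : ℕ) (τ : Fin N → Fin m → ℕ) (k : ℕ)
    (hk : k ≤ m - 1 + N) (i : Fin k) : ℝ :=
  if h : (i : ℕ) < m - 1 then ((i : ℕ) : ℝ) + 1
  else ((activity m (τ ⟨(i : ℕ) - (m - 1), by have := i.isLt; omega⟩) : ℕ) : ℝ)

end ProtUrn

namespace ProtUrn

theorem val_le (m : ℕ) (x : Fin m → ℕ) : val m x ≤ (∑ i, x i) * (m + 1) ^ (m - 1) := by
  unfold val
  rw [Finset.sum_mul]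
  exact Finset.sum_le_sum fun i _ =>
    Nat.mul_le_mul_left _ (Nat.pow_le_pow_right (Nat.succ_pos m) (Nat.sub_le _ _))

theorem sum_fullVec (m : ℕ) (hm : 0 < m) : ∑ i, fullVec m i = m := by
  rw [Finset.sum_eq_single (⟨0, hm⟩ : Fin m)]
  · simp [fullVec]
  · intro b _ hb
    simp only [fullVec, ite_eq_right_iff]
    intro h
    exact absurd (Fin.ext h) hb
  · simp

theorem val_fullVec (m : ℕ) (hm : 0 < m) : val m (fullVec m) = m * (m + 1) ^ (m - 1) := by
  unfold val
  rw [Finset.sum_eq_single (⟨0, hm⟩ : Fin m)]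
  · simp [fullVec]
  · intro b _ hb
    have h : (b : ℕ) ≠ 0 := fun h => hb (Fin.ext h)
    simp [fullVec, h]
  · simp

/-- No composite type precedes `(m, 0, …, 0)`. -/
theorem not_ordGT_fullVec (m : ℕ) (hm : 0 < m) (x : Fin m → ℕ) (hx : ∑ i, x i ≤ m) :
    ¬ OrdGT m x (fullVec m) := by
  have hv := val_le m x
  rintro (h | ⟨h, hlt⟩)
  · rw [sum_fullVec m hm] at h
    omega
  · rw [val_fullVec m hm] at hlt
    rw [h, sum_fullVec m hm] at hv
    omega

/-- Moving one child from `c` to `c + 1` keys preserves the number of children. -/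
theorem sum_addE_subE (m : ℕ) (x : Fin m → ℕ) (c : Fin m) (hc : (c : ℕ) + 1 < m)
    (hx : 0 < x c) : ∑ i, addE m (subE m x c) (c + 1) i = ∑ i, x i := by
  have h : ∀ i : Fin m, addE m (subE m x c) (c + 1) i + (if i = c then 1 else 0) =
      x i + (if i = ⟨c + 1, hc⟩ then 1 else 0) := by
    intro i
    by_cases h : i = c
    · subst h
      simp [addE, subE, Fin.ext_iff]
      omega
    · simp only [addE, subE, Fin.ext_iff] at h ⊢
      split_ifs <;> omega
  have h' := Finset.sum_congr (rfl : (Finset.univ : Finset (Fin m)) = _) fun i _ => h i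
  simp only [Finset.sum_add_distrib, Finset.sum_ite_eq', Finset.mem_univ, if_true] at h'
  omega

theorem sum_subE_le (m : ℕ) (x : Fin m → ℕ) (c : ℕ) : ∑ i, subE m x c i ≤ ∑ i, x i := by
  refine Finset.sum_le_sum fun i _ => ?_
  unfold subE
  split_ifs <;> omega

theorem sum_spawnVec (m : ℕ) (hm : 2 ≤ m) : ∑ i, spawnVec m i = m := by
  obtain ⟨n, rfl⟩ := Nat.exists_eq_add_of_le' hm
  rw [Fin.sum_univ_succ, Fin.sum_univ_succ]
  simp [spawnVec]

/-- A composite type `y` contributes no ball of composite type `j` to the reduced urn, provided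
`y` is not itself the type `j` and deleting its root does not create the type `(m, 0, …, 0)`. -/
theorem red_eq_zero (m N : ℕ) (hm : 2 ≤ m) (τ : Fin N → Fin m → ℕ)
    (τinv : (Fin m → ℕ) → Fin N)
    (hτinv : ∀ x : Fin m → ℕ, (∑ i, x i) ≤ m → τ (τinv x) = x) (k : ℕ) (j : Fin k)
    (s : Fin N) (hs : (j : ℕ) = m - 1 + s) (y : Fin m → ℕ) (hy : ∑ i, y i ≤ m)
    (hne : y ≠ τ s) (hfull : (s : ℕ) = 0 → y ⟨m - 1, by omega⟩ = 0) :
    red m N hm τinv k y j = 0 := by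
  have hne' : (s : ℕ) ≠ τinv y := by
    intro h
    apply hne
    rw [Fin.ext h, hτinv y hy]
  unfold red singles
  rw [if_neg (by omega : ¬ (j : ℕ) = m - 1 + (τinv y : ℕ)),
    dif_neg (by omega : ¬ (j : ℕ) < m - 1)]
  split_ifs with h1 h2
  · rfl
  · exact_mod_cast hfull (by omega)
  · rfl

/-- **Proposition (diagonal entries of the reduced protected-nodes urn, `m ≥ 3`).**
For `m ≥ 3` and `m − 1 ≤ k ≤ q` (`q = m − 1 + C(2m, m)`), the intensity matrix
`A_k` of the reduced Pólya urn `𝒳_n^k` used to count protected nodes in the random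
`m`-ary search tree satisfies `(A_k)_{ii} = −a_i` for every type `i`; that is,
whenever a ball of type `i` is drawn, it is never replaced by a ball of the same
type. Here `τ` enumerates the composite types in the prescribed order (more
children first, ties by decreasing base-`(m+1)` value), and `a_i` is the activity
(number of gaps) of type `i`. -/
theorem protUrn_diagonal (m N : ℕ) (hm : 3 ≤ m) (hN : N = (2 * m).choose m)
    (τ : Fin N → Fin m → ℕ) (τinv : (Fin m → ℕ) → Fin N)
    (hinj : Function.Injective τ)
    (hrange : ∀ x : Fin m → ℕ, x ∈ Set.range τ ↔ ∑ i, x i ≤ m)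
    (horder : ∀ i j : Fin N, i < j → OrdGT m (τ i) (τ j))
    (hτinv : ∀ x : Fin m → ℕ, (∑ i, x i) ≤ m → τ (τinv x) = x)
    (k : ℕ) (hk1 : m - 1 ≤ k) (hk : k ≤ m - 1 + N) :
    ∀ i : Fin k,
      intensityProt m N (by omega) τ τinv k hk i i = -(actGlobal m N τ k hk i) := by
  intro i
  have hm0 : 0 < m := by omega
  simp only [intensityProt, Matrix.of_apply, if_true]
  by_cases h1 : (i : ℕ) < m - 2
  · simp [h1, actGlobal, show (i : ℕ) < m - 1 by omega]
  by_cases h2 : (i : ℕ) = m - 2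
  · have hred : red m N (by omega) τinv k (fullVec m) i = 0 := by
      unfold red singles fullVec
      simp only [show (i : ℕ) ≠ m - 1 + (τinv (fun i => if (i : ℕ) = 0 then m else 0) : ℕ) by omega,
        show (i : ℕ) < m - 1 by omega, show (i : ℕ) ≠ 0 by omega]
      simp
    rw [dif_neg h1, dif_pos h2, hred]
    unfold actGlobal
    rw [dif_pos (by omega), h2]
    push_cast [show 2 ≤ m by omega]
    ring
  rw [dif_neg h1, dif_neg h2]
  simp only [actGlobal, show ¬ (i : ℕ) < m - 1 by omega, dif_neg, not_false_eq_true]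
  have hlt : (i : ℕ) - (m - 1) < N := by have := i.isLt; omega
  obtain ⟨s, hs⟩ : ∃ s : Fin N, s = ⟨(i : ℕ) - (m - 1), hlt⟩ := ⟨_, rfl⟩
  rw [← hs]
  have his : (i : ℕ) = m - 1 + s := by
    rw [hs]
    simp only
    omega
  have hsum : ∑ i, τ s i ≤ m := (hrange _).1 ⟨s, rfl⟩
  have hfirst : (s : ℕ) = 0 → τ s = fullVec m := by
    intro h0
    have hf := hτinv (fullVec m) (sum_fullVec m hm0).le
    by_cases h : s = τinv (fullVec m)
    · rw [h, hf]
    · refine absurd ?_ (not_ordGT_fullVec m hm0 _ hsum)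
      rw [← hf]
      refine horder _ _ (lt_of_le_of_ne ?_ h)
      rw [Fin.le_def]
      omega
  have hgrow : ∀ c : Fin (m - 1), (((c : ℕ) : ℝ) + 1) *
      (τ s (Fin.castLE (by omega) c) : ℝ) *
      red m N (by omega) τinv k (addE m (subE m (τ s) (c : ℕ)) ((c : ℕ) + 1)) i = 0 := by
    intro c
    rcases Nat.eq_zero_or_pos (τ s (Fin.castLE (by omega) c)) with h | h
    · simp [h]
    have hc : ((Fin.castLE (by omega) c : Fin m) : ℕ) + 1 < m := by
      have := c.isLt
      simp only [Fin.val_castLE]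
      omega
    rw [red_eq_zero m N (by omega) τ τinv hτinv k i s his, mul_zero]
    · exact (sum_addE_subE m (τ s) _ hc h).trans_le hsum
    · intro heq
      have := congrFun heq (Fin.castLE (by omega) c)
      simp [addE, subE] at this
      omega
    · intro h0
      rw [hfirst h0] at h ⊢
      have hc0 : (c : ℕ) = 0 := by
        by_contra hc0
        simp [fullVec, hc0] at h
      simp only [addE, subE, fullVec, hc0]
      split_ifs <;> omega
  have hsplit : (m : ℝ) * (τ s ⟨m - 1, by omega⟩ : ℝ) *
      (red m N (by omega) τinv k (subE m (τ s) (m - 1)) i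
        + red m N (by omega) τinv k (spawnVec m) i) = 0 := by
    rcases Nat.eq_zero_or_pos (τ s ⟨m - 1, by omega⟩) with h | h
    · simp [h]
    have hs0 : (s : ℕ) ≠ 0 := by
      intro h0
      rw [hfirst h0] at h
      simp [fullVec, show m - 1 ≠ 0 by omega] at h
    rw [red_eq_zero m N (by omega) τ τinv hτinv k i s his,
      red_eq_zero m N (by omega) τ τinv hτinv k i s his]
    · simp
    · exact (sum_spawnVec m (by omega)).le
    · intro heq
      rw [← heq] at h
      simp [spawnVec, show m - 1 ≠ 0 by omega, show m - 1 ≠ 1 by omega] at h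
    · exact fun h0 => absurd h0 hs0
    · exact (sum_subE_le m _ _).trans hsum
    · intro heq
      have := congrFun heq ⟨m - 1, by omega⟩
      simp [subE] at this
      omega
    · exact fun h0 => absurd h0 hs0
  rw [Finset.sum_eq_zero fun c _ => hgrow c, hsplit]
  ring

end ProtUrn
end
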